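/- Let G be a countably infinite discrete group, let G ↷ X be a free Borel action on a standard Borel space X, let Y ⊆ X be a Borel set such that X \ Y is syndetic, and let φ : Y → {0,1} be a Borel function. Then there exists a family {f_w}_{w ∈ 2^ℕ} of G-equivariant Borel maps f_w : X → 2^G such that: each f_w satisfies closure(f_w(X)) ⊆ Free(2^G) and f_w(y)(1_G) = φ(y) for all y ∈ Y; closure(f_w(X)) ∩ closure(f_z(X)) = ∅ for all distinct w, z ∈ 2^ℕ; the map (w, x) ↦ f_w(x) from 2^ℕ × X to 2^G is Borel; and for each fixed x ∈ X the map w ↦ f_w(x) from 2^ℕ to 2^G is continuous. -/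

import Mathlib

open MeasureTheory Set

/-- The left shift action of `G` on the 2-shift `2^G = G → Bool`:
`(g • w)(h) = w (g⁻¹ * h)`. -/
def shift {G : Type*} [Group G] (g : G) (w : G → Bool) : G → Bool :=
  fun h => w (g⁻¹ * h)

/-- The free part of the 2-shift: points with trivial stabilizer. -/
def FreePart (G : Type*) [Group G] : Set (G → Bool) :=
  {w | ∀ g : G, g ≠ 1 → shift g w ≠ w}

/-- `M ⊆ X` is syndetic if `F • M = X` for some finite `F ⊆ G`. -/
def Syndetic {G X : Type*} [Group G] [MulAction G X] (M : Set X) : Prop :=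
  ∃ F : Finset G, ∀ x : X, ∃ g ∈ F, g⁻¹ • x ∈ M

/-- A local rule that reads only values at points of strictly smaller rank `κ` has a measurable
solution. -/
theorem exists_measurable_fixedPoint {X α : Type*} [MeasurableSpace X] [MeasurableSpace α]
    [Nonempty α] {κ : X → ℕ} (hκ : Measurable κ) (Φ : (X → α) → X → α)
    (hmeas : ∀ v, Measurable v → Measurable (Φ v))
    (hloc : ∀ x v v', (∀ y, κ y < κ x → v y = v' y) → Φ v x = Φ v' x) :
    ∃ v : X → α, Measurable v ∧ ∀ x, Φ v x = v x := by
  obtain ⟨a⟩ := ‹Nonempty α›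
  let V : ℕ → X → α := fun k => Φ^[k] fun _ => a
  have hsucc : ∀ k, V (k + 1) = Φ (V k) := fun k => Function.iterate_succ_apply' Φ k _
  have hV : ∀ k, Measurable (V k) := by
    intro k
    induction k with
    | zero => exact measurable_const
    | succ k ih => rw [hsucc]; exact hmeas _ ih
  have hstab : ∀ k l x, κ x < k → κ x < l → V k x = V l x := by
    intro k
    induction k with
    | zero => intro l x h; omega
    | succ k ih =>
      rintro (_ | l) x hk hl
      · omega
      rw [hsucc, hsucc]
      exact hloc x _ _ fun y hy => ih l y (by omega) (by omega)
  refine ⟨fun x => V (κ x + 1) x, ?_, fun x => ?_⟩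
  · have h : Measurable fun q : ℕ × X => V (q.1 + 1) q.2 :=
      measurable_from_prod_countable_right fun k => hV (k + 1)
    exact h.comp (hκ.prodMk measurable_id)
  · simp only [hsucc]
    exact hloc x _ _ fun y hy => (congrFun (hsucc _) y).symm.trans
      (hstab _ _ _ (by omega) hy)

section Action

variable {G X : Type*} [Group G] [MeasurableSpace X] [MulAction G X] [MeasurableConstSMul G X]
  [Countable G]

theorem exists_measurable_coloring [StandardBorelSpace X]
    (hfree : ∀ (g : G) (x : X), g • x = x → g = 1) (S : Finset G) :
    ∃ κ : X → ℕ, Measurable κ ∧ ∀ x, ∀ s ∈ S, s ≠ 1 → κ (s • x) ≠ κ x := by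
  classical
  let := upgradeStandardBorel X
  rcases isEmpty_or_nonempty X with hX | hX
  · exact ⟨fun _ => 0, measurable_const, fun x => hX.elim x⟩
  obtain ⟨U, hU⟩ := (TopologicalSpace.countable_countableBasis X).exists_eq_range
    (by
      obtain ⟨x⟩ := hX
      obtain ⟨u, hu, -⟩ :=
        (TopologicalSpace.isBasis_countableBasis X).exists_subset_of_mem_open (mem_univ x)
          isOpen_univ
      exact ⟨u, hu⟩)
  have hUm : ∀ n, MeasurableSet (U n) := fun n =>
    (TopologicalSpace.isOpen_of_mem_countableBasis (hU ▸ mem_range_self n)).measurableSet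
  let A : ℕ → Set X := fun n => {x | x ∈ U n ∧ ∀ s ∈ S, s ≠ 1 → s • x ∉ U n}
  have hA : ∀ n, MeasurableSet (A n) := by
    intro n
    refine (hUm n).inter (measurableSet_setOfPred.2 ?_)
    refine Measurable.forall fun s => Measurable.forall fun _ => Measurable.forall fun _ => ?_
    exact (measurableSet_setOfPred.1 (measurable_const_smul s (hUm n))).not
  have hcov : ∀ x, ∃ n, x ∈ A n := by
    intro x
    let C : Set X := ((S.erase 1).image (· • x) : Finset X)
    have hC : IsOpen Cᶜ := (Finset.finite_toSet _).isClosed.isOpen_compl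
    have hx : x ∈ Cᶜ := by
      simp only [C, Finset.coe_image, mem_compl_iff, Set.mem_image, not_exists, not_and]
      intro s hs h
      exact (Finset.mem_erase.1 hs).1 (hfree s x h)
    obtain ⟨u, hu, hxu, huC⟩ :=
      (TopologicalSpace.isBasis_countableBasis X).exists_subset_of_mem_open hx hC
    rw [hU] at hu
    obtain ⟨n, rfl⟩ := hu
    refine ⟨n, hxu, fun s hs h1 hsx => huC hsx ?_⟩
    exact Finset.mem_coe.2 (Finset.mem_image_of_mem _ (Finset.mem_erase.2 ⟨h1, hs⟩))
  refine ⟨fun x => Nat.find (hcov x), measurable_find hcov hA, fun x s hs h1 h => ?_⟩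
  have h2 := (Nat.find_spec (hcov x)).2 s hs h1
  have h3 := (Nat.find_spec (hcov (s • x))).1
  simp only at h
  rw [h] at h3
  exact h2 h3

theorem exists_measurable_maximal_separated [StandardBorelSpace X]
    (hfree : ∀ (g : G) (x : X), g • x = x → g = 1) {S : Finset G} (h1 : 1 ∈ S)
    (hinv : ∀ s ∈ S, s⁻¹ ∈ S) {D : Set X} (hD : MeasurableSet D) :
    ∃ M ⊆ D, MeasurableSet M ∧ (∀ x ∈ M, ∀ s ∈ S, s • x ∈ M → s = 1) ∧
      ∀ x ∈ D, ∃ s ∈ S, s • x ∈ M := by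
  obtain ⟨κ, hκ, hκS⟩ := exists_measurable_coloring hfree S
  obtain ⟨v, hv, hfix⟩ := exists_measurable_fixedPoint hκ
    (fun (v : X → Prop) x => x ∈ D ∧ ∀ s ∈ S, κ (s • x) < κ x → ¬ v (s • x)) (by
      intro v hv
      refine (measurableSet_setOfPred.1 hD).and <|
        Measurable.forall fun s => Measurable.forall fun _ => Measurable.imp ?_ ?_
      · exact measurableSet_setOfPred.1 (measurableSet_lt (hκ.comp (measurable_const_smul s)) hκ)
      · exact (hv.comp (measurable_const_smul s)).not) (by
      intro x v v' h
      simp only [eq_iff_iff, and_congr_right_iff]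
      exact fun _ => forall₃_congr fun s _ hlt => by rw [h _ hlt])
  have hfix' : ∀ x, v x ↔ x ∈ D ∧ ∀ s ∈ S, κ (s • x) < κ x → ¬ v (s • x) :=
    fun x => (iff_of_eq (hfix x)).symm
  refine ⟨{x | v x}, fun x hx => ((hfix' x).1 hx).1, measurableSet_setOfPred.2 hv, ?_, ?_⟩
  · intro x hx s hs hsx
    by_contra hne
    rcases lt_or_gt_of_ne (hκS x s hs hne) with h | h
    · exact ((hfix' x).1 hx).2 s hs h hsx
    · refine ((hfix' _).1 hsx).2 s⁻¹ (hinv s hs) ?_ ?_ <;> rw [inv_smul_smul]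
      · exact h
      · exact hx
  · intro x hx
    by_cases hvx : v x
    · exact ⟨1, h1, by simpa using hvx⟩
    · have := (hfix' x).not.1 hvx
      push Not at this
      obtain ⟨s, hs, -, h⟩ := this hx
      exact ⟨s, hs, h⟩

/-- Refilling the disjoint blocks `E • x`, `x ∈ M`, inside `D`, so that every block satisfies a
local requirement that may also read blocks of smaller rank. -/
theorem exists_block_filling {E : Finset G} {M D : Set X} (hM : MeasurableSet M)
    (hD : MeasurableSet D)
    (hsep : ∀ x ∈ M, ∀ e ∈ E, ∀ e' ∈ E, (e'⁻¹ * e) • x ∈ M → e' = e)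
    {κ : X → ℕ} (hκ : Measurable κ) {P : X → (G → Bool) → Prop}
    (hmeas : ∀ p : X → G → Bool, Measurable p → MeasurableSet {x | P x (p x)})
    (hloc : ∀ x ∈ M, ∀ p p' : G → Bool,
      (∀ h, (h ∈ E ∨ ∀ e ∈ E, (e⁻¹ * h) • x ∈ M → κ ((e⁻¹ * h) • x) < κ x) → p h = p' h) →
        P x p → P x p')
    (hex : ∀ x ∈ M, ∀ p : G → Bool, ∃ a : G → Bool, ∀ q : G → Bool,
      (∀ h ∈ E, h • x ∈ D → q h = a h) → (∀ h, ¬ (h ∈ E ∧ h • x ∈ D) → q h = p h) → P x q)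
    {φ : X → Bool} (hφ : Measurable φ) :
    ∃ c : X → Bool, Measurable c ∧ (∀ x ∉ D, c x = φ x) ∧ ∀ x ∈ M, P x fun h => c (h • x) := by
  classical
  let fill : (X → E → Bool) → X → Bool := fun v y =>
    decide ((y ∈ D ∧ ∃ e : E, (e : G)⁻¹ • y ∈ M ∧ v ((e : G)⁻¹ • y) e = true) ∨
      ¬ (y ∈ D ∧ ∃ e : E, (e : G)⁻¹ • y ∈ M) ∧ φ y = true)
  have hfill_meas : ∀ v, Measurable v → Measurable (fill v) := by
    intro v hv
    have hin : ∀ e : E, MeasurableSet {y : X | (e : G)⁻¹ • y ∈ M} := fun e =>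
      measurable_const_smul (e : G)⁻¹ hM
    have hval : ∀ e : E, MeasurableSet {y : X | v ((e : G)⁻¹ • y) e = true} := fun e =>
      ((measurable_pi_apply e).comp (hv.comp (measurable_const_smul (e : G)⁻¹)))
        (measurableSet_singleton true)
    refine measurable_to_bool ?_
    have : fill v ⁻¹' {true} =
        (D ∩ ⋃ e : E, {y : X | (e : G)⁻¹ • y ∈ M} ∩ {y : X | v ((e : G)⁻¹ • y) e = true}) ∪
          ((D ∩ ⋃ e : E, {y : X | (e : G)⁻¹ • y ∈ M})ᶜ ∩ φ ⁻¹' {true}) := by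
      ext y
      simp only [fill, mem_preimage, mem_singleton_iff, decide_eq_true_eq, mem_union, mem_inter_iff,
        mem_iUnion, mem_compl_iff, mem_ofPred_eq]
    rw [this]
    exact (hD.inter (MeasurableSet.iUnion fun e => (hin e).inter (hval e))).union
      ((hD.inter (MeasurableSet.iUnion hin)).compl.inter (hφ (measurableSet_singleton _)))
  have hfill_congr : ∀ v v' y, (∀ e : E, (e : G)⁻¹ • y ∈ M → v ((e : G)⁻¹ • y) =
      v' ((e : G)⁻¹ • y)) → fill v y = fill v' y := by
    intro v v' y h
    simp only [fill]
    congr 2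
    refine propext (and_congr_right fun _ => exists_congr fun e => and_congr_right fun he => ?_)
    rw [h e he]
  have hfill_out : ∀ v, ∀ y ∉ D, fill v y = φ y := by
    intro v y hy
    simp [fill, hy]
  have hfill_in : ∀ v, ∀ x ∈ M, ∀ e : E, (e : G) • x ∈ D → fill v ((e : G) • x) = v x e := by
    intro v x hx e hex
    have huniq : ∀ e' : E, (e' : G)⁻¹ • (e : G) • x ∈ M → e' = e := by
      intro e' he'
      rw [← mul_smul] at he'
      exact Subtype.ext (hsep x hx e e.2 e' e'.2 he')
    have hxM : (e : G)⁻¹ • (e : G) • x ∈ M := by rwa [inv_smul_smul]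
    have h1 : (∃ e' : E, (e' : G)⁻¹ • (e : G) • x ∈ M ∧
        v ((e' : G)⁻¹ • (e : G) • x) e' = true) ↔ v x e = true := by
      constructor
      · rintro ⟨e', he', h⟩
        obtain rfl := huniq e' he'
        rwa [inv_smul_smul] at h
      · intro h
        exact ⟨e, hxM, by rwa [inv_smul_smul]⟩
    have h2 : ∃ e' : E, (e' : G)⁻¹ • (e : G) • x ∈ M := ⟨e, hxM⟩
    simp only [fill, hex, true_and, h1, h2, not_true_eq_false, false_and, or_false,
      Bool.decide_eq_true]
  let pick : ((E → Bool) → Prop) → E → Bool := fun Q =>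
    if h : ∃ a, Q a then h.choose else fun _ => false
  have hpick : ∀ Q : (E → Bool) → Prop, (∃ a, Q a) → Q (pick Q) := by
    intro Q h
    simp only [pick, dif_pos h]
    exact h.choose_spec
  let trunc : ℕ → (X → E → Bool) → X → E → Bool := fun k v y =>
    if κ y < k then v y else fun _ => false
  have htrunc : ∀ k v, Measurable v → Measurable (trunc k v) := fun k v hv =>
    Measurable.ite (measurableSet_lt hκ measurable_const) hv measurable_const
  let view : (X → E → Bool) → X → (E → Bool) → G → Bool := fun v x a h =>
    if hE : h ∈ E ∧ h • x ∈ D then a ⟨h, hE.1⟩ else fill (trunc (κ x) v) (h • x)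
  obtain ⟨v, hv, hfix⟩ := exists_measurable_fixedPoint hκ
    (fun v x => pick fun a => P x (view v x a)) (by
      intro v hv
      refine (measurable_of_finite pick).comp (measurable_pi_iff.2 fun a => ?_)
      refine measurableSet_setOfPred.1 (hmeas _ (measurable_pi_iff.2 fun h => ?_))
      have hb : Measurable fun x => fill (trunc (κ x) v) (h • x) := by
        have : Measurable fun q : ℕ × X => fill (trunc q.1 v) (h • q.2) :=
          measurable_from_prod_countable_right fun k =>
            (hfill_meas _ (htrunc k v hv)).comp (measurable_const_smul h)
        exact this.comp (hκ.prodMk measurable_id)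
      by_cases hE : h ∈ E
      · have hview : (fun x => view v x a h) = fun x =>
            if h • x ∈ D then a ⟨h, hE⟩ else fill (trunc (κ x) v) (h • x) := by
          funext x
          by_cases hx : h • x ∈ D <;> simp [view, hE, hx]
        rw [hview]
        exact Measurable.ite (p := fun x => h • x ∈ D) (measurable_const_smul h hD)
          measurable_const hb
      · simpa only [view, hE, false_and, dite_false] using hb) (by
      intro x v v' h
      have : trunc (κ x) v = trunc (κ x) v' := by
        funext y
        by_cases hy : κ y < κ x
        · simp only [trunc, if_pos hy, h y hy]
        · simp only [trunc, if_neg hy]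
      simp only [view, this])
  refine ⟨fill v, hfill_meas v hv, hfill_out v, fun x hx => ?_⟩
  have hP : P x (view v x (v x)) := by
    conv => arg 2; arg 3; rw [← hfix x]
    refine hpick (fun a => P x (view v x a)) ?_
    obtain ⟨a, ha⟩ := hex x hx fun h => fill (trunc (κ x) v) (h • x)
    refine ⟨fun e => a e, ha _ (fun h hE hxD => ?_) (fun h hh => ?_)⟩
    · simp only [view, dif_pos (And.intro hE hxD)]
    · simp only [view, dif_neg hh]
  refine hloc x hx _ _ (fun h hh => ?_) hP
  by_cases hhE : h ∈ E ∧ h • x ∈ D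
  · simp only [view, dif_pos hhE]
    exact (hfill_in v x hx ⟨h, hhE.1⟩ hhE.2).symm
  · simp only [view, dif_neg hhE]
    by_cases hxD : h • x ∈ D
    · refine hfill_congr _ _ _ fun e he => ?_
      rw [← mul_smul] at he ⊢
      simp only [trunc, if_pos ((hh.resolve_left fun h' => hhE ⟨h', hxD⟩) e e.2 he)]
    · rw [hfill_out _ _ hxD, hfill_out _ _ hxD]

end Action

section Combinatorics

theorem exists_mul_pow_lt_two_pow (C k : ℕ) : ∃ m, C * (m + 1) ^ k < 2 ^ m := by
  have h := tendsto_pow_const_div_const_pow_of_one_lt (r := (2 : ℝ)) k one_lt_two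
  have h' := (h.comp (Filter.tendsto_add_atTop_nat 1)).eventually_lt_const
    (show (0 : ℝ) < 1 / (2 * (C + 1)) by positivity)
  obtain ⟨m, hm⟩ := h'.exists
  refine ⟨m, ?_⟩
  simp only [Function.comp_apply] at hm
  rw [div_lt_div_iff₀ (by positivity) (by positivity), pow_succ] at hm
  push_cast at hm
  have h1 : ((C : ℝ) + 1) * (m + 1) ^ k < 2 ^ m := by linarith
  have h2 : (C : ℝ) * (m + 1) ^ k ≤ (C + 1) * (m + 1) ^ k := by gcongr; linarith
  exact_mod_cast h2.trans_lt h1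

variable {G : Type*} [Group G]

theorem exists_disjoint_translates [Infinite G] (F : Finset G) (n : ℕ) :
    ∃ Q : Finset G, Q.card = n ∧
      ∀ q ∈ Q, ∀ q' ∈ Q, ∀ f ∈ F, ∀ f' ∈ F, f * q = f' * q' → q = q' := by
  classical
  induction n with
  | zero => exact ⟨∅, rfl, by simp⟩
  | succ n ih =>
    obtain ⟨Q, hQ, hdisj⟩ := ih
    obtain ⟨r, hr⟩ := Infinite.exists_notMem_finset
      (Q ∪ (F ×ˢ F ×ˢ Q).image fun t => t.1⁻¹ * (t.2.1 * t.2.2))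
    simp only [Finset.mem_union, not_or] at hr
    have hne : ∀ q ∈ Q, ∀ f ∈ F, ∀ f' ∈ F, f * r ≠ f' * q := by
      intro q hq f hf f' hf' h
      refine hr.2 (Finset.mem_image.2 ⟨(f, f', q), ?_, ?_⟩)
      · simp [hf, hf', hq]
      · simp [← h]
    refine ⟨insert r Q, by rw [Finset.card_insert_of_notMem hr.1, hQ], ?_⟩
    intro q hq q' hq' f hf f' hf' h
    rcases Finset.mem_insert.1 hq with hqr | hq <;> rcases Finset.mem_insert.1 hq' with hqr' | hq'
    · rw [hqr, hqr']
    · exact (hne q' hq' f hf f' hf' (hqr ▸ h)).elim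
    · exact (hne q hq f' hf' f hf (hqr' ▸ h.symm)).elim
    · exact hdisj q hq q' hq' f hf f' hf' h

theorem exists_subset_disjoint_translate (B : Finset G) {γ : G} (hγ : γ ≠ 1) :
    ∃ A ⊆ B, B.card ≤ 3 * A.card ∧ ∀ a ∈ A, a * γ ∉ A := by
  classical
  obtain ⟨A, hA, hmax⟩ := Finset.exists_max_image
    (B.powerset.filter fun A => ∀ a ∈ A, a * γ ∉ A) Finset.card ⟨∅, by simp⟩
  simp only [Finset.mem_filter, Finset.mem_powerset] at hA
  refine ⟨A, hA.1, ?_, hA.2⟩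
  have hsub : B ⊆ A ∪ A.image (· * γ) ∪ A.image (· * γ⁻¹) := by
    intro b hb
    by_contra hcon
    simp only [Finset.mem_union, Finset.mem_image, not_or, not_exists, not_and] at hcon
    obtain ⟨⟨h1, h2⟩, h3⟩ := hcon
    have := hmax (insert b A) (by
      simp only [Finset.mem_filter, Finset.mem_powerset]
      refine ⟨Finset.insert_subset hb hA.1, fun a ha hmem => ?_⟩
      rcases Finset.mem_insert.1 ha with rfl | ha <;> rcases Finset.mem_insert.1 hmem with h | h
      · exact hγ (mul_eq_left.1 h)
      · exact h3 _ h (by group)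
      · exact h2 a ha h
      · exact hA.2 a ha h)
    rw [Finset.card_insert_of_notMem h1] at this
    omega
  calc B.card ≤ _ := Finset.card_le_card hsub
    _ ≤ A.card + (A.image (· * γ)).card + (A.image (· * γ⁻¹)).card :=
      (Finset.card_union_le _ _).trans (by gcongr; exact Finset.card_union_le _ _)
    _ ≤ A.card + A.card + A.card := 
      Nat.add_le_add (Nat.add_le_add le_rfl Finset.card_image_le) Finset.card_image_le
    _ = 3 * A.card := by ring

theorem exists_word_avoiding {α ι : Type*} (E : Finset α) (I : Finset ι) {m : ℕ}
    (hI : I.card < 2 ^ m) (Bad : ι → (α → Bool) → Prop)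
    (h : ∀ i ∈ I, ∃ A ⊆ E, m ≤ A.card ∧ ∀ a a', Bad i a → Bad i a' →
      (∀ h ∉ A, a h = a' h) → ∀ h ∈ A, a h = a' h) :
    ∃ a, ∀ i ∈ I, ¬ Bad i a := by
  classical
  rcases I.eq_empty_or_nonempty with rfl | hne
  · exact ⟨fun _ => false, by simp⟩
  let B : ι → Finset (Finset α) := fun i => E.powerset.filter fun s => Bad i fun h => decide (h ∈ s)
  have hB : ∀ i ∈ I, (B i).card ≤ 2 ^ (E.card - m) := by
    intro i hi
    obtain ⟨A, hAE, hmA, hA⟩ := h i hi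
    calc (B i).card ≤ (E \ A).powerset.card := by
          refine Finset.card_le_card_of_injOn (· \ A) ?_ ?_
          · intro s hs
            simp only [B, Finset.coe_filter, Finset.mem_powerset, mem_ofPred_eq] at hs
            exact Finset.mem_coe.2
              (Finset.mem_powerset.2 (Finset.sdiff_subset_sdiff hs.1 subset_rfl))
          · intro s hs s' hs' heq
            simp only [B, Finset.coe_filter, Finset.mem_powerset, mem_ofPred_eq] at hs hs'
            have hout : ∀ h ∉ A, (h ∈ s ↔ h ∈ s') := fun h hh => by
              have := Finset.ext_iff.1 heq h
              simpa [hh] using this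
            ext h
            by_cases hh : h ∈ A
            · simpa using hA _ _ hs.2 hs'.2 (fun h hh => by simp [hout h hh]) h hh
            · exact hout h hh
      _ = 2 ^ (E.card - A.card) := by rw [Finset.card_powerset, Finset.card_sdiff_of_subset hAE]
      _ ≤ 2 ^ (E.card - m) := Nat.pow_le_pow_right two_pos (by omega)
  have hmE : m ≤ E.card := by
    obtain ⟨i, hi⟩ := hne
    obtain ⟨A, hAE, hmA, -⟩ := h i hi
    exact hmA.trans (Finset.card_le_card hAE)
  have hlt : (I.biUnion B).card < E.powerset.card := by
    calc (I.biUnion B).card ≤ I.card * 2 ^ (E.card - m) := Finset.card_biUnion_le_card_mul _ _ _ hB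
      _ < 2 ^ m * 2 ^ (E.card - m) := by gcongr
      _ = E.powerset.card := by rw [Finset.card_powerset, ← pow_add, Nat.add_sub_cancel' hmE]
  obtain ⟨s, hs, hsB⟩ := Finset.exists_mem_notMem_of_card_lt_card hlt
  refine ⟨fun h => decide (h ∈ s), fun i hi hbad => hsB ?_⟩
  exact Finset.mem_biUnion.2 ⟨i, hi, Finset.mem_filter.2 ⟨hs, hbad⟩⟩

theorem exists_word_ne_translate {N Γ : Finset G} (hΓ : 1 ∉ Γ) {m : ℕ} (hm : Γ.card < 2 ^ m)
    {B : G → Finset G} (hBN : ∀ γ ∈ Γ, B γ ⊆ N) (hB : ∀ γ ∈ Γ, 3 * m ≤ (B γ).card)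
    (p : G → Bool) :
    ∃ a : G → Bool, ∀ q : G → Bool, (∀ h ∈ N, q h = a h) → (∀ h ∉ N, q h = p h) →
      ∀ γ ∈ Γ, ∃ e ∈ B γ, q e ≠ q (e * γ) := by
  classical
  let view : (G → Bool) → G → Bool := fun a h => if h ∈ N then a h else p h
  obtain ⟨a, ha⟩ := exists_word_avoiding N Γ hm
    (fun γ a => ∀ e ∈ B γ, view a e = view a (e * γ)) (by
      intro γ hγ
      obtain ⟨A, hAB, hcard, hdisj⟩ :=
        exists_subset_disjoint_translate (B γ) (fun h : γ = 1 => hΓ (h ▸ hγ))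
      refine ⟨A, hAB.trans (hBN γ hγ), by have := hB γ hγ; omega, ?_⟩
      intro a a' ha ha' hout e he
      have hN : e ∈ N := hBN γ hγ (hAB he)
      have h1 := ha e (hAB he)
      have h2 := ha' e (hAB he)
      have h3 : view a (e * γ) = view a' (e * γ) := by
        simp only [view, hout _ (hdisj e he)]
      simp only [view, if_pos hN] at h1 h2
      rw [h1, h2]
      exact h3)
  refine ⟨a, fun q hqa hqp γ hγ => ?_⟩
  have hq : q = view a := by
    funext h
    by_cases hh : h ∈ N
    · simp only [view, if_pos hh, hqa h hh]
    · simp only [view, if_neg hh, hqp h hh]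
  have := ha γ hγ
  push Not at this
  rwa [hq]

end Combinatorics

section FreeStages

open scoped Pointwise

variable {G X : Type*} [Group G] [MeasurableSpace X] [MulAction G X] [MeasurableConstSMul G X]
  [Countable G] [Infinite G] [StandardBorelSpace X]

/-- One can change any coloring on `D \ D'`, for some syndetic `D' ⊆ D`, so that no later change on
`D'` makes a point look like its `g`-translate. -/
theorem exists_free_stage (hfree : ∀ (g : G) (x : X), g • x = x → g = 1) {D : Set X}
    (hD : MeasurableSet D) (hsyn : ∃ F : Finset G, ∀ x : X, ∃ f ∈ F, f • x ∈ D)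
    {g : G} (hg : g ≠ 1) :
    ∃ D' ⊆ D, MeasurableSet D' ∧ (∃ F : Finset G, ∀ x : X, ∃ f ∈ F, f • x ∈ D') ∧
      ∃ T : Finset G, ∀ φ : X → Bool, Measurable φ → ∃ c : X → Bool, Measurable c ∧
        (∀ x, x ∉ D \ D' → c x = φ x) ∧ ∀ ψ : X → Bool, (∀ x ∉ D', ψ x = c x) →
          ∀ x, ∃ t ∈ T, ψ ((t * g) • x) ≠ ψ (t • x) := by
  classical
  obtain ⟨F, hF1, hF⟩ : ∃ F : Finset G, 1 ∈ F ∧ ∀ x : X, ∃ f ∈ F, f • x ∈ D := by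
    obtain ⟨F, hF⟩ := hsyn
    refine ⟨insert 1 F, Finset.mem_insert_self _ _, fun x => ?_⟩
    obtain ⟨f, hf, h⟩ := hF x
    exact ⟨f, Finset.mem_insert_of_mem hf, h⟩
  obtain ⟨m, hm⟩ := exists_mul_pow_lt_two_pow (2 * (F.card * 3) ^ 6) 6
  obtain ⟨Q, hQ, hFQ⟩ := exists_disjoint_translates F (3 * m + 2)
  let E := F * Q
  have hEcard : E.card ≤ F.card * 3 * (m + 1) := by
    calc E.card ≤ F.card * Q.card := Finset.card_mul_le
      _ ≤ F.card * (3 * (m + 1)) := by rw [hQ]; gcongr; omega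
      _ = _ := by ring
  obtain ⟨e₀, he₀⟩ : E.Nonempty := by
    refine Finset.Nonempty.mul ⟨1, hF1⟩ (Finset.card_pos.1 (by omega))
  let L := E⁻¹ * E
  have hL1 : (1 : G) ∈ L :=
    Finset.mem_mul.2 ⟨e₀⁻¹, Finset.inv_mem_inv he₀, e₀, he₀, inv_mul_cancel e₀⟩
  have hLmem : ∀ e ∈ E, ∀ e' ∈ E, e⁻¹ * e' ∈ L := fun e he e' he' =>
    Finset.mul_mem_mul (Finset.inv_mem_inv he) he'
  have hLinv : L⁻¹ = L := by simp [L, mul_inv_rev]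
  let S := L * L
  have hLS : L ⊆ S := fun l hl => by simpa using Finset.mul_mem_mul hl hL1
  have hSinv : ∀ s ∈ S, s⁻¹ ∈ S := by
    intro s hs
    have : S⁻¹ = S := by simp [S, mul_inv_rev, hLinv]
    rw [← this]
    exact Finset.inv_mem_inv hs
  obtain ⟨D', hD'D, hD', hD'sep, hD'max⟩ := exists_measurable_maximal_separated hfree
    (S := E * E⁻¹) (D := D)
    (Finset.mem_mul.2 ⟨e₀, he₀, e₀⁻¹, Finset.inv_mem_inv he₀, mul_inv_cancel e₀⟩)
    (fun s hs => by
      have : (E * E⁻¹)⁻¹ = E * E⁻¹ := by simp [mul_inv_rev]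
      rw [← this]
      exact Finset.inv_mem_inv hs) hD
  obtain ⟨M, -, hM, hMsep, hMmax⟩ := exists_measurable_maximal_separated hfree
    (S := S) (D := univ) (hLS hL1) hSinv MeasurableSet.univ
  let W := S * L
  have hSW : S ⊆ W := fun s hs => by simpa using Finset.mul_mem_mul hs hL1
  let Γ := (W ×ˢ {g, g⁻¹}).image fun q => q.1⁻¹ * q.2 * q.1
  have hΓmem : ∀ u ∈ W, u⁻¹ * g * u ∈ Γ ∧ u⁻¹ * g⁻¹ * u ∈ Γ := fun u hu =>
    ⟨Finset.mem_image.2 ⟨(u, g), by simp [hu], rfl⟩,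
      Finset.mem_image.2 ⟨(u, g⁻¹), by simp [hu], rfl⟩⟩
  have hΓ1 : 1 ∉ Γ := by
    intro h
    obtain ⟨⟨u, k⟩, hk, h⟩ := Finset.mem_image.1 h
    have hk1 : k = 1 := by
      have h2 : u⁻¹ * k * u = 1 := h
      calc k = u * (u⁻¹ * k * u) * u⁻¹ := by group
        _ = 1 := by rw [h2]; group
    simp only [Finset.mem_product, Finset.mem_insert, Finset.mem_singleton] at hk
    rcases hk.2 with h | h
    · exact hg (h ▸ hk1)
    · exact hg (inv_eq_one.1 (h ▸ hk1))
  have hΓcard : Γ.card < 2 ^ m := by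
    have hLc : L.card ≤ E.card ^ 2 := by
      calc L.card ≤ E⁻¹.card * E.card := Finset.card_mul_le
        _ = E.card ^ 2 := by rw [Finset.card_inv, sq]
    calc Γ.card ≤ (W ×ˢ {g, g⁻¹}).card := Finset.card_image_le
      _ ≤ W.card * 2 := by rw [Finset.card_product]; gcongr; exact Finset.card_le_two
      _ ≤ (L.card * L.card * L.card) * 2 := by
        gcongr
        exact Finset.card_mul_le.trans (by gcongr; exact Finset.card_mul_le)
      _ ≤ ((F.card * 3 * (m + 1)) ^ 2 * (F.card * 3 * (m + 1)) ^ 2 *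
          (F.card * 3 * (m + 1)) ^ 2) * 2 := by
        have := hLc.trans (Nat.pow_le_pow_left hEcard 2)
        gcongr
      _ = 2 * (F.card * 3) ^ 6 * (m + 1) ^ 6 := by ring
      _ < 2 ^ m := hm
  obtain ⟨κ, hκ, hκne⟩ := exists_measurable_coloring hfree (L * Γ)
  let P : X → (G → Bool) → Prop := fun x p => ∀ γ ∈ Γ,
    (∀ e ∈ E, ∀ e' ∈ E, (e'⁻¹ * (e * γ)) • x ∈ M →
      e * γ = e' ∨ κ ((e'⁻¹ * (e * γ)) • x) < κ x) →
    ∃ e ∈ E, e • x ∈ D \ D' ∧ (e * γ) • x ∉ D' ∧ p e ≠ p (e * γ)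
  have hsmul : ∀ {s : Set X}, MeasurableSet s → ∀ h : G, Measurable fun x => h • x ∈ s :=
    fun hs h => measurableSet_setOfPred.1 (measurable_const_smul h hs)
  have hfill := fun (φ : X → Bool) (hφ : Measurable φ) =>
    exists_block_filling (E := E) (D := D \ D') hM (hD.diff hD')
      (fun x hx e he e' he' h =>
        inv_mul_eq_one.1 (hMsep x hx _ (hLS (hLmem e' he' e he)) h)) hκ (P := P) (by
      intro p hp
      have hp' : ∀ h, Measurable fun x => p x h := fun h => (measurable_pi_apply h).comp hp
      refine measurableSet_setOfPred.2 (Measurable.forall fun γ => Measurable.forall fun _ =>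
        Measurable.imp ?_ ?_)
      · refine Measurable.forall fun e => Measurable.forall fun _ => Measurable.forall fun e' =>
          Measurable.forall fun _ => (hsmul hM _).imp (measurable_const.or ?_)
        exact measurableSet_setOfPred.1 (measurableSet_lt (hκ.comp (measurable_const_smul _)) hκ)
      · refine Measurable.exists fun e => measurable_const.and <|
          (hsmul (hD.diff hD') e).and <| (hsmul hD' _).not.and ?_
        exact measurableSet_setOfPred.1 (measurableSet_eq_fun (hp' _) (hp' _)).compl) (by
      intro x hx p p' hpp hP γ hγ hrel
      obtain ⟨e, he, h1, h2, h3⟩ := hP γ hγ hrel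
      refine ⟨e, he, h1, h2, ?_⟩
      rw [← hpp e (Or.inl he), ← hpp (e * γ) ?_]
      · exact h3
      · by_cases hin : e * γ ∈ E
        · exact Or.inl hin
        · exact Or.inr fun e' he' hM' => (hrel e he e' he' hM').resolve_left
            fun h => hin (h ▸ he')) (by
      intro x hx p
      obtain ⟨a, ha⟩ := exists_word_ne_translate (N := E.filter fun h => h • x ∈ D \ D') hΓ1 hΓcard
        (B := fun γ => E.filter fun e => e • x ∈ D \ D' ∧ (e * γ) • x ∉ D') (by
          intro γ hγ e he
          rw [Finset.mem_filter] at he ⊢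
          exact ⟨he.1, he.2.1⟩) (by
          intro γ hγ
          have hone : ∀ y : X, (E.filter fun e => e • y ∈ D').card ≤ 1 := by
            intro y
            refine Finset.card_le_one.2 fun e he e' he' => ?_
            rw [Finset.mem_filter] at he he'
            have := hD'sep _ he'.2 (e * e'⁻¹)
              (Finset.mul_mem_mul he.1 (Finset.inv_mem_inv he'.1)) (by
                rw [← mul_smul, inv_mul_cancel_right]; exact he.2)
            exact mul_inv_eq_one.1 this
          have hmany : 3 * m + 2 ≤ (E.filter fun e => e • x ∈ D).card := by
            choose t ht htD using fun q : G => hF (q • x)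
            rw [← hQ]
            refine Finset.card_le_card_of_injOn (fun q => t q * q) ?_ ?_
            · intro q hq
              simp only [Finset.coe_filter, mem_ofPred_eq, mul_smul]
              exact ⟨Finset.mul_mem_mul (ht q) hq, htD q⟩
            · intro q hq q' hq' h
              exact hFQ q hq q' hq' _ (ht q) _ (ht q') h
          have hsub : (E.filter fun e => e • x ∈ D) ⊆
              (E.filter fun e => e • x ∈ D \ D' ∧ (e * γ) • x ∉ D') ∪
                (E.filter fun e => e • x ∈ D') ∪ (E.filter fun e => e • γ • x ∈ D') := by
            intro e he
            simp only [Finset.mem_union, Finset.mem_filter, mem_sdiff, mul_smul] at he ⊢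
            tauto
          have h1 := Finset.card_le_card hsub
          have h2 := Finset.card_union_le ((E.filter fun e => e • x ∈ D \ D' ∧ (e * γ) • x ∉ D') ∪
                (E.filter fun e => e • x ∈ D')) (E.filter fun e => e • γ • x ∈ D')
          have h3 := Finset.card_union_le (E.filter fun e => e • x ∈ D \ D' ∧ (e * γ) • x ∉ D')
                (E.filter fun e => e • x ∈ D')
          have h4 := hone x
          have h5 := hone (γ • x)
          omega) p
      refine ⟨a, fun q hqa hqp γ hγ _ => ?_⟩
      obtain ⟨e, he, hne⟩ := ha q
        (fun h hh => hqa h (Finset.mem_filter.1 hh).1 (Finset.mem_filter.1 hh).2)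
        (fun h hh => hqp h fun h' => hh (Finset.mem_filter.2 h')) γ hγ
      rw [Finset.mem_filter] at he
      exact ⟨e, he.1, he.2.1, he.2.2, hne⟩) hφ
  refine ⟨D', hD'D, hD', ⟨E * E⁻¹ * F, fun x => ?_⟩, E * W⁻¹, fun φ hφ => ?_⟩
  · obtain ⟨f, hf, hfx⟩ := hF x
    obtain ⟨s, hs, hsx⟩ := hD'max _ hfx
    exact ⟨s * f, Finset.mul_mem_mul hs hf, by rwa [mul_smul]⟩
  obtain ⟨c, hc, hcφ, hcP⟩ := hfill φ hφ
  refine ⟨c, hc, hcφ, fun ψ hψ x => ?_⟩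
  have hne : ∀ y ∈ M, ∀ γ ∈ Γ, (∀ e ∈ E, ∀ e' ∈ E, (e'⁻¹ * (e * γ)) • y ∈ M →
      e * γ = e' ∨ κ ((e'⁻¹ * (e * γ)) • y) < κ y) →
      ∃ e ∈ E, ψ (e • y) ≠ ψ ((e * γ) • y) := by
    intro y hy γ hγ hrel
    obtain ⟨e, he, h1, h2, h3⟩ := hcP y hy γ hγ hrel
    exact ⟨e, he, by rwa [hψ _ h1.2, hψ _ h2]⟩
  obtain ⟨s, hs, hsx⟩ := hMmax x (mem_univ x)
  obtain ⟨u, hu, y, hy, rfl⟩ : ∃ u ∈ S, ∃ y ∈ M, x = u • y :=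
    ⟨s⁻¹, hSinv s hs, s • x, hsx, (inv_smul_smul s x).symm⟩
  by_cases hrel : ∀ e ∈ E, ∀ e' ∈ E, (e'⁻¹ * (e * (u⁻¹ * g * u))) • y ∈ M →
      e * (u⁻¹ * g * u) = e' ∨ κ ((e'⁻¹ * (e * (u⁻¹ * g * u))) • y) < κ y
  · obtain ⟨e, he, h⟩ := hne y hy _ (hΓmem u (hSW hu)).1 hrel
    refine ⟨e * u⁻¹, Finset.mul_mem_mul he (Finset.inv_mem_inv (hSW hu)), ?_⟩
    rw [← mul_smul, ← mul_smul, inv_mul_cancel_right, mul_assoc, mul_assoc, ← mul_assoc u⁻¹]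
    exact h.symm
  · push Not at hrel
    obtain ⟨e, he, e', he', hz, hne', hκz⟩ := hrel
    obtain ⟨z, hzdef⟩ : ∃ z, z = (e'⁻¹ * (e * (u⁻¹ * g * u))) • y := ⟨_, rfl⟩
    rw [← hzdef] at hz hκz
    have hκlt : κ y < κ z := by
      refine lt_of_le_of_ne hκz fun h => ?_
      refine hκne y (e'⁻¹ * (e * (u⁻¹ * g * u))) ?_ ?_ ?_
      · rw [← mul_assoc]
        exact Finset.mul_mem_mul (hLmem e' he' e he) (hΓmem u (hSW hu)).1
      · exact fun h => hne' (inv_mul_eq_one.1 h).symm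
      · rw [← hzdef, h]
    let u' := u * (e⁻¹ * e')
    have hu' : u' ∈ W := Finset.mul_mem_mul hu (hLmem e he e' he')
    have hback : (u'⁻¹ * g⁻¹ * u') • z = (e'⁻¹ * e) • y := by
      rw [hzdef, ← mul_smul]
      congr 1
      simp only [u']
      group
    obtain ⟨f, hf, h⟩ := hne z hz _ (hΓmem u' hu').2 (by
      intro f hf f' hf' hM'
      right
      have hy' : (f'⁻¹ * (f * (u'⁻¹ * g⁻¹ * u'))) • z = (f'⁻¹ * f * (e'⁻¹ * e)) • y := by
        rw [← mul_assoc, mul_smul, hback, ← mul_smul]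
      rw [hy'] at hM' ⊢
      rw [hMsep y hy _ (Finset.mul_mem_mul (hLmem f' hf' f hf) (hLmem e' he' e he)) hM', one_smul]
      exact hκlt)
    refine ⟨f * u'⁻¹, Finset.mul_mem_mul hf (Finset.inv_mem_inv hu'), ?_⟩
    have h1 : (f * u'⁻¹ * g) • u • y = f • z := by
      rw [hzdef, ← mul_smul, ← mul_smul]
      congr 1
      simp only [u']
      group
    have h2 : (f * u'⁻¹) • u • y = (f * (u'⁻¹ * g⁻¹ * u')) • z := by
      rw [mul_smul f, mul_smul f, hback, ← mul_smul u'⁻¹]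
      congr 2
      simp only [u']
      group
    rwa [h1, h2]

end FreeStages

section ParityWords

variable {G : Type*} [Group G]

theorem even_sum_toNat_congr {α : Type*} {F : Finset α} {u v : α → Bool}
    (h : ∀ f ∈ F, u f = v f) :
    Even (∑ f ∈ F, (u f).toNat) ↔ Even (∑ f ∈ F, (v f).toNat) := by
  rw [Finset.sum_congr rfl fun f hf => congrArg Bool.toNat (h f hf)]

theorem eq_of_even_sum_toNat {α : Type*} [DecidableEq α] {F : Finset α} {t : α} (ht : t ∈ F)
    {u v : α → Bool} (hu : Even (∑ f ∈ F, (u f).toNat)) (hv : Even (∑ f ∈ F, (v f).toNat))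
    (h : ∀ f ∈ F, f ≠ t → u f = v f) : u t = v t := by
  rw [← Finset.add_sum_erase _ _ ht] at hu hv
  rw [Finset.sum_congr rfl fun f hf => by
    rw [h f (Finset.mem_of_mem_erase hf) (Finset.ne_of_mem_erase hf)]] at hu
  rw [Nat.even_add] at hu hv
  have := hu.trans hv.symm
  revert this
  cases u t <;> cases v t <;> simp

theorem exists_word_forall_even {F Q : Finset G}
    (hFQ : ∀ q ∈ Q, ∀ q' ∈ Q, ∀ f ∈ F, ∀ f' ∈ F, f * q = f' * q' → q = q') {N : Finset G}
    (hN : ∀ q ∈ Q, ∃ f ∈ F, f * q ∈ N) (p : G → Bool) :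
    ∃ a : G → Bool, ∀ u : G → Bool, (∀ h ∈ N, u h = a h) → (∀ h ∉ N, u h = p h) →
      ∀ q ∈ Q, Even (∑ f ∈ F, (u (f * q)).toNat) := by
  classical
  choose! t ht htN using hN
  let p₀ : G → Bool := fun h => if h ∈ N then false else p h
  refine ⟨fun h => decide (∃ q ∈ Q, h = t q * q ∧ ¬ Even (∑ f ∈ F, (p₀ (f * q)).toNat)),
    fun u hua hup q hq => ?_⟩
  have hrest : ∀ f ∈ F.erase (t q), (u (f * q)).toNat = (p₀ (f * q)).toNat := by
    intro f hf
    obtain ⟨hne, hfF⟩ := Finset.mem_erase.1 hf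
    by_cases hfN : f * q ∈ N
    · simp only [p₀, if_pos hfN, hua _ hfN]
      congr 1
      refine decide_eq_false ?_
      rintro ⟨q', hq', h, -⟩
      obtain rfl := hFQ q hq q' hq' f hfF _ (ht q' hq') h
      exact hne (mul_right_cancel h)
    · simp only [p₀, if_neg hfN, hup _ hfN]
  have htq : u (t q * q) = decide (¬ Even (∑ f ∈ F, (p₀ (f * q)).toNat)) := by
    rw [hua _ (htN q hq)]
    refine decide_eq_decide.2 ⟨?_, fun h => ⟨q, hq, rfl, h⟩⟩
    rintro ⟨q', hq', h, hodd⟩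
    obtain rfl := hFQ q hq q' hq' _ (ht q hq) _ (ht q' hq') h
    exact hodd
  have hp₀ : p₀ (t q * q) = false := if_pos (htN q hq)
  rw [← Finset.add_sum_erase _ _ (ht q hq), Finset.sum_congr rfl hrest, htq,
    ← Finset.add_sum_erase _ (fun f => (p₀ (f * q)).toNat) (ht q hq), hp₀, Bool.toNat_false,
    zero_add, Nat.even_add]
  by_cases h : Even (∑ f ∈ F.erase (t q), (p₀ (f * q)).toNat) <;> simp [h]

theorem exists_word_forall_exists_odd {F Q V : Finset G}
    (hFQ : ∀ q ∈ Q, ∀ q' ∈ Q, ∀ f ∈ F, ∀ f' ∈ F, f * q = f' * q' → q = q')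
    (hV : V.card < 2 ^ Q.card) {N : Finset G} (hN : ∀ s ∈ V, ∀ q ∈ Q, ∃ f ∈ F, f * q * s ∈ N)
    (p : G → Bool) :
    ∃ a : G → Bool, ∀ u : G → Bool, (∀ h ∈ N, u h = a h) → (∀ h ∉ N, u h = p h) →
      ∀ s ∈ V, ∃ q ∈ Q, ¬ Even (∑ f ∈ F, (u (f * q * s)).toNat) := by
  classical
  let view : (G → Bool) → G → Bool := fun a h => if h ∈ N then a h else p h
  obtain ⟨a, ha⟩ := exists_word_avoiding N V hV
    (fun s a => ∀ q ∈ Q, Even (∑ f ∈ F, (view a (f * q * s)).toNat)) (by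
      intro s hs
      choose! t ht htN using hN s hs
      have hinj : ∀ q ∈ Q, ∀ f ∈ F, ∀ q' ∈ Q, f * q * s = t q' * q' * s → q = q' ∧ f = t q := by
        intro q hq f hf q' hq' h
        have h' := mul_right_cancel h
        obtain rfl := hFQ q hq q' hq' f hf _ (ht q' hq') h'
        exact ⟨rfl, mul_right_cancel h'⟩
      refine ⟨Q.image fun q => t q * q * s, Finset.image_subset_iff.2 htN, ?_, ?_⟩
      · rw [Finset.card_image_of_injOn]
        exact fun q hq q' hq' h => (hinj q hq _ (ht q hq) q' hq' h).1
      · intro a a' ha ha' hout h hh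
        obtain ⟨q, hq, rfl⟩ := Finset.mem_image.1 hh
        have := eq_of_even_sum_toNat (ht q hq) (ha q hq) (ha' q hq) (by
          intro f hf hft
          have : f * q * s ∉ Q.image fun q => t q * q * s := by
            intro hmem
            obtain ⟨q', hq', h⟩ := Finset.mem_image.1 hmem
            exact hft (hinj q hq f hf q' hq' h.symm).2
          simp only [view, hout _ this])
        simpa only [view, if_pos (htN q hq)] using this)
  refine ⟨a, fun u hua hup s hs => ?_⟩
  have hu : u = view a := by
    funext h
    by_cases hh : h ∈ N
    · simp only [view, if_pos hh, hua h hh]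
    · simp only [view, if_neg hh, hup h hh]
  have := ha s hs
  push Not at this
  rwa [hu]

theorem preimage_restrict_image_eq {G : Type*} {N : Finset G} {S : Set (G → Bool)}
    (h : ∀ p p' : G → Bool, (∀ h ∈ N, p h = p' h) → p ∈ S → p' ∈ S) :
    N.restrict ⁻¹' (N.restrict '' S) = S := by
  refine Subset.antisymm ?_ (subset_preimage_image _ _)
  rintro p ⟨p', hp', heq⟩
  exact h p' p (fun h hh => congrFun heq ⟨h, hh⟩) hp'

theorem isClopen_of_finset_coordinates {G : Type*} (N : Finset G) {S : Set (G → Bool)}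
    (h : ∀ p p' : G → Bool, (∀ h ∈ N, p h = p' h) → p ∈ S → p' ∈ S) : IsClopen S := by
  rw [← preimage_restrict_image_eq h]
  exact (isClopen_discrete _).preimage (Finset.continuous_restrict N)

theorem measurableSet_of_finset_coordinates {G : Type*} (N : Finset G) {S : Set (G → Bool)}
    (h : ∀ p p' : G → Bool, (∀ h ∈ N, p h = p' h) → p ∈ S → p' ∈ S) : MeasurableSet S := by
  rw [← preimage_restrict_image_eq h]
  exact Finset.measurable_restrict N (toFinite _).measurableSet

end ParityWords

section BitStages

open scoped Pointwise

variable {G X : Type*} [Group G] [MeasurableSpace X] [MulAction G X] [MeasurableConstSMul G X]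
  [Countable G]

theorem exists_uniform_block_filling {E : Finset G} {M D : Set X} (hM : MeasurableSet M)
    (hD : MeasurableSet D)
    (hsep : ∀ x ∈ M, ∀ e ∈ E, ∀ e' ∈ E, (e'⁻¹ * e) • x ∈ M → e' = e) {S : Set (G → Bool)}
    (hS : ∀ p p' : G → Bool, (∀ h ∈ E, p h = p' h) → p ∈ S → p' ∈ S)
    (hex : ∀ x ∈ M, ∀ N : Finset G, (∀ h, h ∈ N ↔ h ∈ E ∧ h • x ∈ D) → ∀ p : G → Bool,
      ∃ a : G → Bool, ∀ q : G → Bool, (∀ h ∈ N, q h = a h) → (∀ h ∉ N, q h = p h) → q ∈ S)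
    {φ : X → Bool} (hφ : Measurable φ) :
    ∃ c : X → Bool, Measurable c ∧ (∀ x ∉ D, c x = φ x) ∧ ∀ x ∈ M, (fun h => c (h • x)) ∈ S := by
  classical
  refine exists_block_filling hM hD hsep (κ := fun _ => 0) measurable_const (P := fun _ p => p ∈ S)
    (fun p hp => hp (measurableSet_of_finset_coordinates E hS))
    (fun x _ p p' h => hS p p' fun k hk => h k (Or.inl hk)) (fun x hx p => ?_) hφ
  obtain ⟨a, ha⟩ := hex x hx (E.filter fun h => h • x ∈ D) (fun h => Finset.mem_filter) p
  exact ⟨a, fun q h1 h2 => ha q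
    (fun h hh => h1 h (Finset.mem_filter.1 hh).1 (Finset.mem_filter.1 hh).2)
    fun h hh => h2 h fun h' => hh (Finset.mem_filter.2 h')⟩

variable [Infinite G] [StandardBorelSpace X]

/-- Syndetic markers whose `L`-blocks are pairwise disjoint and avoid any sufficiently separated
set; the syndeticity window `V` has size quadratic in `L`. -/
theorem exists_far_markers (hfree : ∀ (g : G) (x : X), g • x = x → g = 1) {L : Finset G}
    (hL : L.Nonempty) :
    ∃ K V : Finset G, V.card ≤ 2 * L.card ^ 2 ∧ ∀ D' : Set X, MeasurableSet D' →
      (∀ x ∈ D', ∀ k ∈ K, k • x ∈ D' → k = 1) →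
        ∃ M : Set X, MeasurableSet M ∧
          (∀ x ∈ M, ∀ e ∈ L, ∀ e' ∈ L, (e'⁻¹ * e) • x ∈ M → e' = e) ∧
          (∀ x ∈ M, ∀ l ∈ L, l • x ∉ D') ∧ ∀ x : X, ∃ s ∈ V, s • x ∈ M := by
  classical
  obtain ⟨h, hh⟩ := Infinite.exists_notMem_finset (L⁻¹ * L)
  obtain ⟨l₀, hl₀⟩ := hL
  refine ⟨L * {h} * L⁻¹, L⁻¹ * L * {1, h}, ?_, fun D' hD' hsep => ?_⟩
  · calc (L⁻¹ * L * {1, h}).card ≤ (L⁻¹.card * L.card) * 2 :=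
          Finset.card_mul_le.trans (Nat.mul_le_mul Finset.card_mul_le Finset.card_le_two)
      _ = 2 * L.card ^ 2 := by rw [Finset.card_inv]; ring
  obtain ⟨M, hMZ, hM, hMsep, hMmax⟩ := exists_measurable_maximal_separated hfree (S := L⁻¹ * L)
    (D := {x | ∀ l ∈ L, l • x ∉ D'})
    (Finset.mem_mul.2 ⟨l₀⁻¹, Finset.inv_mem_inv hl₀, l₀, hl₀, inv_mul_cancel l₀⟩)
    (fun s hs => by
      have : (L⁻¹ * L)⁻¹ = L⁻¹ * L := by simp [mul_inv_rev]
      rw [← this]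
      exact Finset.inv_mem_inv hs)
    (measurableSet_setOfPred.2 <| Measurable.forall fun l => Measurable.forall fun _ =>
      (measurableSet_setOfPred.1 (measurable_const_smul l hD')).not)
  refine ⟨M, hM, fun x hx e he e' he' hM' => inv_mul_eq_one.1 (hMsep x hx _
    (Finset.mul_mem_mul (Finset.inv_mem_inv he') he) hM'), fun x hx => hMZ hx, fun x => ?_⟩
  obtain ⟨r, hr, hrx⟩ : ∃ r ∈ ({1, h} : Finset G), ∀ l ∈ L, l • r • x ∉ D' := by
    by_contra! hcon
    obtain ⟨l, hl, hlx⟩ := hcon 1 (by simp)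
    obtain ⟨l', hl', hlx'⟩ := hcon h (by simp)
    rw [one_smul] at hlx
    have hk := hsep _ hlx (l' * h * l⁻¹) (Finset.mul_mem_mul
      (Finset.mul_mem_mul hl' (Finset.mem_singleton_self h)) (Finset.inv_mem_inv hl))
      (by rwa [mul_smul, inv_smul_smul, mul_smul])
    refine hh (Finset.mem_mul.2 ⟨l'⁻¹, Finset.inv_mem_inv hl', l, hl, ?_⟩)
    rw [← mul_inv_eq_one.1 hk, inv_mul_cancel_left]
  obtain ⟨s, hs, hsx⟩ := hMmax (r • x) hrx
  exact ⟨s * r, Finset.mul_mem_mul hs hr, by rwa [mul_smul]⟩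

/-- One can encode a bit `b` into any coloring by changing it on `D \ D'`, for some syndetic
`D' ⊆ D`, so that the bit survives every later change on `D'`. -/
theorem exists_bit_stage (hfree : ∀ (g : G) (x : X), g • x = x → g = 1) {D : Set X}
    (hD : MeasurableSet D) (hsyn : ∃ F : Finset G, ∀ x : X, ∃ f ∈ F, f • x ∈ D) :
    ∃ D' ⊆ D, MeasurableSet D' ∧ (∃ F : Finset G, ∀ x : X, ∃ f ∈ F, f • x ∈ D') ∧
      ∃ S : Set (G → Bool), IsClopen S ∧ ∀ (b : Bool) (φ : X → Bool), Measurable φ →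
        ∃ c : X → Bool, Measurable c ∧ (∀ x, x ∉ D \ D' → c x = φ x) ∧
          ∀ ψ : X → Bool, (∀ x ∉ D', ψ x = c x) →
            ∀ x, (fun h => ψ (h • x)) ∈ S ↔ b = true := by
  classical
  obtain ⟨F, hF1, hF⟩ : ∃ F : Finset G, 1 ∈ F ∧ ∀ x : X, ∃ f ∈ F, f • x ∈ D := by
    obtain ⟨F, hF⟩ := hsyn
    refine ⟨insert 1 F, Finset.mem_insert_self _ _, fun x => ?_⟩
    obtain ⟨f, hf, h⟩ := hF x
    exact ⟨f, Finset.mem_insert_of_mem hf, h⟩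
  obtain ⟨m, hm⟩ := exists_mul_pow_lt_two_pow (2 * F.card ^ 2) 2
  obtain ⟨Q, hQ, hFQ⟩ := exists_disjoint_translates F (m + 1)
  have hE : (F * Q).Nonempty := Finset.Nonempty.mul ⟨1, hF1⟩ (Finset.card_pos.1 (by omega))
  obtain ⟨K₀, V₀, hV₀, hmark₀⟩ := exists_far_markers hfree hE
  have hV₀lt : V₀.card < 2 ^ Q.card := by
    calc V₀.card ≤ 2 * (F.card * Q.card) ^ 2 :=
          hV₀.trans (by gcongr; exact Finset.card_mul_le)
      _ = 2 * F.card ^ 2 * (m + 1) ^ 2 := by rw [hQ]; ring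
      _ < 2 ^ m := hm
      _ ≤ 2 ^ Q.card := Nat.pow_le_pow_right two_pos (by omega)
  obtain ⟨K₁, V₁, -, hmark₁⟩ := exists_far_markers hfree
    (hE.mul (Finset.insert_nonempty 1 V₀))
  let K := insert 1 (K₀ ∪ K₁)
  obtain ⟨D', hD'D, hD', hD'sep, hD'max⟩ := exists_measurable_maximal_separated hfree
    (S := K ∪ K⁻¹) (D := D) (by simp [K]) (fun s hs => by
      rw [Finset.mem_union, Finset.mem_inv'] at hs ⊢
      rwa [inv_inv, or_comm]) hD
  obtain ⟨M₀, hM₀, hsep₀, hfar₀, hsyn₀⟩ := hmark₀ D' hD' fun x hx k hk =>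
    hD'sep x hx k (by simp [K, hk])
  obtain ⟨M₁, hM₁, hsep₁, hfar₁, hsyn₁⟩ := hmark₁ D' hD' fun x hx k hk =>
    hD'sep x hx k (by simp [K, hk])
  have hmul : ∀ {f q s : G}, f ∈ F → q ∈ Q → s ∈ V₀ → f * q * s ∈ F * Q * insert 1 V₀ :=
    fun hf hq hs => Finset.mul_mem_mul (Finset.mul_mem_mul hf hq) (Finset.mem_insert_of_mem hs)
  have hfill₀ := fun (φ : X → Bool) (hφ : Measurable φ) =>
    exists_uniform_block_filling hM₀ (hD.diff hD') hsep₀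
      (S := {p | ∀ q ∈ Q, Even (∑ f ∈ F, (p (f * q)).toNat)}) (by
        intro p p' h hp q hq
        exact (even_sum_toNat_congr fun f hf => h _ (Finset.mul_mem_mul hf hq)).1 (hp q hq)) (by
        intro x hx N hN p
        refine exists_word_forall_even hFQ (fun q hq => ?_) p
        obtain ⟨f, hf, hfD⟩ := hF (q • x)
        have hfq := Finset.mul_mem_mul hf hq
        rw [← mul_smul] at hfD
        exact ⟨f, hf, (hN _).2 ⟨hfq, hfD, hfar₀ x hx _ hfq⟩⟩) hφ
  have hfill₁ := fun (φ : X → Bool) (hφ : Measurable φ) =>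
    exists_uniform_block_filling hM₁ (hD.diff hD') hsep₁
      (S := {p | ∀ s ∈ V₀, ∃ q ∈ Q, ¬ Even (∑ f ∈ F, (p (f * q * s)).toNat)}) (by
        intro p p' h hp s hs
        obtain ⟨q, hq, hodd⟩ := hp s hs
        exact ⟨q, hq, (even_sum_toNat_congr fun f hf => h _ (hmul hf hq hs)).not.1 hodd⟩) (by
        intro x hx N hN p
        refine exists_word_forall_exists_odd hFQ hV₀lt (fun s hs q hq => ?_) p
        obtain ⟨f, hf, hfD⟩ := hF (q • s • x)
        have hfq := hmul hf hq hs
        rw [← mul_smul, ← mul_smul] at hfD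
        exact ⟨f, hf, (hN _).2 ⟨hfq, hfD, hfar₁ x hx _ hfq⟩⟩) hφ
  refine ⟨D', hD'D, hD', ⟨(K ∪ K⁻¹) * F, fun x => ?_⟩,
    {p | ∃ t ∈ V₁, ∀ s ∈ V₀, ∃ q ∈ Q, ¬ Even (∑ f ∈ F, (p (f * q * s * t)).toNat)},
    isClopen_of_finset_coordinates (F * Q * V₀ * V₁) ?_, ?_⟩
  · obtain ⟨f, hf, hfx⟩ := hF x
    obtain ⟨s, hs, hsx⟩ := hD'max _ hfx
    exact ⟨s * f, Finset.mul_mem_mul hs hf, by rwa [mul_smul]⟩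
  · rintro p p' h ⟨t, ht, hp⟩
    refine ⟨t, ht, fun s hs => ?_⟩
    obtain ⟨q, hq, hodd⟩ := hp s hs
    exact ⟨q, hq, (even_sum_toNat_congr fun f hf => h _ (Finset.mul_mem_mul
      (Finset.mul_mem_mul (Finset.mul_mem_mul hf hq) hs) ht)).not.1 hodd⟩
  rintro (_ | _) φ hφ
  · obtain ⟨c, hc, hcφ, hcS⟩ := hfill₀ φ hφ
    refine ⟨c, hc, hcφ, fun ψ hψ x => iff_of_false ?_ Bool.false_ne_true⟩
    rintro ⟨t, ht, h⟩
    obtain ⟨s, hs, hsx⟩ := hsyn₀ (t • x)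
    obtain ⟨q, hq, hodd⟩ := h s hs
    refine hodd ((even_sum_toNat_congr fun f hf => ?_).1 (hcS _ hsx q hq))
    simp only [mul_smul _ t, mul_smul _ s]
    exact (hψ _ (hfar₀ _ hsx _ (Finset.mul_mem_mul hf hq))).symm
  · obtain ⟨c, hc, hcφ, hcS⟩ := hfill₁ φ hφ
    refine ⟨c, hc, hcφ, fun ψ hψ x => iff_of_true ?_ rfl⟩
    obtain ⟨t, ht, htx⟩ := hsyn₁ x
    refine ⟨t, ht, fun s hs => ?_⟩
    obtain ⟨q, hq, hodd⟩ := hcS _ htx s hs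
    refine ⟨q, hq, (even_sum_toNat_congr fun f hf => ?_).not.1 hodd⟩
    simp only [mul_smul _ t]
    exact (hψ _ (hfar₁ _ htx _ (hmul hf hq hs))).symm

theorem exists_stage (hfree : ∀ (g : G) (x : X), g • x = x → g = 1) {D : Set X}
    (hD : MeasurableSet D) (hsyn : ∃ F : Finset G, ∀ x : X, ∃ f ∈ F, f • x ∈ D) (g : G) :
    ∃ D' ⊆ D, MeasurableSet D' ∧ (∃ F : Finset G, ∀ x : X, ∃ f ∈ F, f • x ∈ D') ∧
      ∃ R : Bool → Set (G → Bool), (∀ b, IsClosed (R b)) ∧ Disjoint (R true) (R false) ∧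
        (g ≠ 1 → ∀ b, ∀ p ∈ R b, ∃ t, p (t * g) ≠ p t) ∧
        ∀ (b : Bool) (φ : X → Bool), Measurable φ → ∃ c : X → Bool, Measurable c ∧
          (∀ x, x ∉ D \ D' → c x = φ x) ∧ ∀ ψ : X → Bool, (∀ x ∉ D', ψ x = c x) →
            ∀ x, (fun h => ψ (h • x)) ∈ R b := by
  obtain ⟨D₁, hD₁D, hD₁, hsyn₁, S₁, hS₁, hgS₁, hfill₁⟩ : ∃ D' ⊆ D, MeasurableSet D' ∧
      (∃ F : Finset G, ∀ x : X, ∃ f ∈ F, f • x ∈ D') ∧ ∃ S : Set (G → Bool), IsClosed S ∧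
        (g ≠ 1 → ∀ p ∈ S, ∃ t, p (t * g) ≠ p t) ∧
        ∀ φ : X → Bool, Measurable φ → ∃ c : X → Bool, Measurable c ∧
          (∀ x, x ∉ D \ D' → c x = φ x) ∧ ∀ ψ : X → Bool, (∀ x ∉ D', ψ x = c x) →
            ∀ x, (fun h => ψ (h • x)) ∈ S := by
    classical
    by_cases hg : g = 1
    · exact ⟨D, subset_rfl, hD, hsyn, univ, isClosed_univ, fun h => (h hg).elim,
        fun φ hφ => ⟨φ, hφ, fun _ _ => rfl, fun _ _ _ => mem_univ _⟩⟩
    · obtain ⟨D', hD'D, hD', hsyn', T, hT⟩ := exists_free_stage hfree hD hsyn hg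
      refine ⟨D', hD'D, hD', hsyn', {p | ∃ t ∈ T, p (t * g) ≠ p t},
        (isClopen_of_finset_coordinates (T * {g} ∪ T) ?_).isClosed,
        fun _ p ⟨t, _, h⟩ => ⟨t, h⟩, hT⟩
      rintro p p' h ⟨t, ht, hne⟩
      refine ⟨t, ht, ?_⟩
      rwa [← h t (by simp [ht]), ← h (t * g) (Finset.mem_union_left _
        (Finset.mul_mem_mul ht (Finset.mem_singleton_self g)))]
  obtain ⟨D₂, hD₂D, hD₂, hsyn₂, S₂, hS₂, hfill₂⟩ := exists_bit_stage hfree hD₁ hsyn₁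
  refine ⟨D₂, hD₂D.trans hD₁D, hD₂, hsyn₂, fun b => S₁ ∩ {p | p ∈ S₂ ↔ b = true}, ?_, ?_,
    fun hg b p hp => hgS₁ hg p hp.1, fun b φ hφ => ?_⟩
  · rintro (_ | _)
    · convert hS₁.inter hS₂.compl.isClosed using 2
      ext p
      simp
    · convert hS₁.inter hS₂.isClosed using 2
      ext p
      simp
  · exact disjoint_left.2 fun p hp hp' => Bool.false_ne_true (hp'.2.1 (hp.2.2 rfl))
  · obtain ⟨c₁, hc₁, hcφ₁, h₁⟩ := hfill₁ φ hφ
    obtain ⟨c₂, hc₂, hcφ₂, h₂⟩ := hfill₂ b c₁ hc₁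
    refine ⟨c₂, hc₂, fun x hx => ?_, fun ψ hψ x => ⟨h₁ ψ (fun y hy => ?_) x, h₂ ψ hψ x⟩⟩
    · rw [hcφ₂ x fun h => hx ⟨hD₁D h.1, h.2⟩, hcφ₁ x fun h => hx ⟨h.1, fun h' => h.2 (hD₂D h')⟩]
    · rw [hψ y fun h => hy (hD₂D h), hcφ₂ y fun h => hy h.1]

end BitStages

section Family

variable {G X : Type*} [Group G] [MeasurableSpace X] [MulAction G X] [MeasurableConstSMul G X]
  [Countable G] [Infinite G] [StandardBorelSpace X]

theorem exists_stage_sequence (hfree : ∀ (g : G) (x : X), g • x = x → g = 1) {D₀ : Set X}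
    (hD₀ : MeasurableSet D₀) (hsyn : ∃ F : Finset G, ∀ x : X, ∃ f ∈ F, f • x ∈ D₀) (g : ℕ → G) :
    ∃ (D : ℕ → Set X) (R : ℕ → Bool → Set (G → Bool)) (Ψ : ℕ → Bool → (X → Bool) → X → Bool),
      D 0 = D₀ ∧ Antitone D ∧ (∀ n b, IsClosed (R n b)) ∧
      (∀ n, Disjoint (R n true) (R n false)) ∧
      (∀ n, g n ≠ 1 → ∀ b, ∀ p ∈ R n b, ∃ t, p (t * g n) ≠ p t) ∧
      (∀ n b φ, Measurable φ → Measurable (Ψ n b φ)) ∧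
      (∀ n b φ, Measurable φ → ∀ x ∉ D n \ D (n + 1), Ψ n b φ x = φ x) ∧
      ∀ n b φ, Measurable φ → ∀ ψ : X → Bool, (∀ x ∉ D (n + 1), ψ x = Ψ n b φ x) →
        ∀ x, (fun h => ψ (h • x)) ∈ R n b := by
  choose D' hsub hmeas hsyn' R hRc hRd hRg Ψ hΨm hΨφ hΨR using
    fun (D : {D : Set X // MeasurableSet D ∧ ∃ F : Finset G, ∀ x : X, ∃ f ∈ F, f • x ∈ D})
      (k : G) => exists_stage hfree D.2.1 D.2.2 k
  let D : ℕ → {D : Set X // MeasurableSet D ∧ ∃ F : Finset G, ∀ x : X, ∃ f ∈ F, f • x ∈ D} :=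
    fun n => Nat.rec (motive := fun _ => {D : Set X // MeasurableSet D ∧
      ∃ F : Finset G, ∀ x : X, ∃ f ∈ F, f • x ∈ D}) ⟨D₀, hD₀, hsyn⟩
      (fun n D => ⟨D' D (g n), hmeas D (g n), hsyn' D (g n)⟩) n
  classical
  let Ψ' : ℕ → Bool → (X → Bool) → X → Bool := fun n b φ =>
    if hφ : Measurable φ then Ψ (D n) (g n) b φ hφ else φ
  have hΨ' : ∀ n b φ (hφ : Measurable φ), Ψ' n b φ = Ψ (D n) (g n) b φ hφ :=
    fun n b φ hφ => dif_pos hφ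
  have hanti : Antitone fun n => (D n : Set X) :=
    antitone_nat_of_succ_le fun n => hsub (D n) (g n)
  refine ⟨fun n => D n, fun n => R (D n) (g n), Ψ', rfl,
    hanti, fun n => hRc _ _, fun n => hRd _ _,
    fun n => hRg _ _, fun n b φ hφ => ?_, fun n b φ hφ => ?_, fun n b φ hφ => ?_⟩
  · rw [hΨ' n b φ hφ]
    exact hΨm _ _ _ _ _
  · rw [hΨ' n b φ hφ]
    exact hΨφ _ _ _ _ _
  · rw [hΨ' n b φ hφ]
    exact hΨR _ _ _ _ _

theorem exists_coloring_family (hfree : ∀ (g : G) (x : X), g • x = x → g = 1) {D₀ : Set X}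
    (hD₀ : MeasurableSet D₀) (hsyn : ∃ F : Finset G, ∀ x : X, ∃ f ∈ F, f • x ∈ D₀)
    {φ : X → Bool} (hφ : Measurable φ) (g : ℕ → G) :
    ∃ (c : (ℕ → Bool) → X → Bool) (R : ℕ → Bool → Set (G → Bool)),
      (∀ w, Measurable (c w)) ∧ (∀ w, ∀ x ∉ D₀, c w x = φ x) ∧
      (∀ x, Continuous fun w => c w x) ∧ (∀ n b, IsClosed (R n b)) ∧
      (∀ n, Disjoint (R n true) (R n false)) ∧
      (∀ n, g n ≠ 1 → ∀ b, ∀ p ∈ R n b, ∃ t, p (t * g n) ≠ p t) ∧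
      ∀ w n x, (fun h => c w (h • x)) ∈ R n (w n) := by
  classical
  obtain ⟨D, R, Ψ, rfl, hanti, hRc, hRd, hRg, hΨm, hΨφ, hΨR⟩ :=
    exists_stage_sequence hfree hD₀ hsyn g
  let C : ℕ → (ℕ → Bool) → X → Bool := fun n w =>
    Nat.rec (motive := fun _ => X → Bool) φ (fun k c => Ψ k (w k) c) n
  have hC : ∀ n w, Measurable (C n w) := by
    intro n w
    induction n with
    | zero => exact hφ
    | succ n ih => exact hΨm n _ _ ih
  have hCsucc : ∀ n w, ∀ x ∉ D n \ D (n + 1), C (n + 1) w x = C n w x :=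
    fun n w x hx => hΨφ n _ _ (hC n w) x hx
  have hCstable : ∀ n w, ∀ x ∉ D n, ∀ m ≥ n, C m w x = C n w x := by
    intro n w x hx m hm
    induction m, hm using Nat.le_induction with
    | base => rfl
    | succ m hm ih => rw [hCsucc m w x fun h => hx (hanti hm h.1), ih]
  have hCconst : ∀ w x, (∀ n, x ∈ D n) → ∀ n, C n w x = φ x := by
    intro w x hx n
    induction n with
    | zero => rfl
    | succ n ih => rw [hCsucc n w x fun h => h.2 (hx _), ih]
  have hClocal : ∀ n w w', (∀ i ∈ Finset.range n, w i = w' i) → C n w = C n w' := by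
    intro n w w' h
    induction n with
    | zero => rfl
    | succ n ih =>
      change Ψ n (w n) (C n w) = Ψ n (w' n) (C n w')
      rw [h n (by simp), ih fun i hi => h i (by simp at hi ⊢; omega)]
  let c : (ℕ → Bool) → X → Bool := fun w x => decide (∃ N : ℕ, ∀ n ≥ N, C n w x = true)
  have hc_eq : ∀ w x N, (∀ n ≥ N, C n w x = C N w x) → c w x = C N w x := by
    intro w x N h
    rw [Bool.eq_iff_iff, decide_eq_true_iff]
    constructor
    · rintro ⟨N', h'⟩
      rw [← h _ (le_max_left N N')]
      exact h' _ (le_max_right N N')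
    · exact fun hN => ⟨N, fun n hn => (h n hn).trans hN⟩
  have hc_out : ∀ n w, ∀ x ∉ D n, c w x = C n w x :=
    fun n w x hx => hc_eq w x n (hCstable n w x hx)
  refine ⟨c, R, fun w => ?_, fun w x hx => hc_out 0 w x hx, fun x => ?_, hRc, hRd, hRg,
    fun w n x => ?_⟩
  · refine measurable_to_bool ?_
    have : c w ⁻¹' {true} = {x | ∃ N, ∀ n ≥ N, C n w x = true} := by
      ext x
      simp [c]
    rw [this]
    exact measurableSet_setOfPred.2 <| Measurable.exists fun N => Measurable.forall fun n =>
      Measurable.forall fun _ => measurableSet_setOfPred.1 (hC n w (measurableSet_singleton true))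
  · obtain ⟨n, hn⟩ : ∃ n, ∀ w, c w x = C n w x := by
      by_cases hx : ∃ n, x ∉ D n
      · obtain ⟨n, hn⟩ := hx
        exact ⟨n, fun w => hc_out n w x hn⟩
      · push Not at hx
        exact ⟨0, fun w => hc_eq w x 0 fun n _ => hCconst w x hx n⟩
    refine continuous_discrete_rng.2 fun b => ?_
    refine (isClopen_of_finset_coordinates (Finset.range n) fun w w' h hw => ?_).isOpen
    rw [mem_preimage, mem_singleton_iff, hn] at hw ⊢
    rwa [← hClocal n w w' h]
  · exact hΨR n (w n) (C n w) (hC n w) (c w) (fun y hy => hc_out (n + 1) w y hy) x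

end Family

/-- Theorem 1.1.(2): there is a family `{f_w}_{w ∈ 2^ℕ}` of `G`-equivariant Borel maps
`X → 2^G`, each with closure of its image inside the free part and extending `φ` at `1_G`,
whose images have pairwise disjoint closures, such that `(w, x) ↦ f_w x` is Borel and
`w ↦ f_w x` is continuous for each fixed `x`. -/
theorem family_of_equivariant_maps_into_free_part
    {G : Type*} [Group G] [Countable G] [Infinite G]
    {X : Type*} [MeasurableSpace X] [StandardBorelSpace X] [MulAction G X]
    (hBorel : ∀ g : G, Measurable fun x : X => g • x)
    (hfree : ∀ (g : G) (x : X), g • x = x → g = 1)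
    (Y : Set X) (hY : MeasurableSet Y) (hYc : Syndetic (G := G) Yᶜ)
    (φ : Y → Bool) (hφ : Measurable φ) :
    ∃ f : (ℕ → Bool) → X → (G → Bool),
      (∀ w : ℕ → Bool, Measurable (f w)) ∧
      (∀ (w : ℕ → Bool) (g : G) (x : X), f w (g • x) = shift g (f w x)) ∧
      (∀ w : ℕ → Bool, closure (Set.range (f w)) ⊆ FreePart G) ∧
      (∀ (w : ℕ → Bool) (y : Y), f w (y : X) 1 = φ y) ∧
      (∀ w z : ℕ → Bool, w ≠ z →
        closure (Set.range (f w)) ∩ closure (Set.range (f z)) = ∅) ∧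
      Measurable (fun p : (ℕ → Bool) × X => f p.1 p.2) ∧
      (∀ x : X, Continuous fun w : ℕ → Bool => f w x) := by
  classical
  have : MeasurableConstSMul G X := ⟨hBorel⟩
  obtain ⟨g, hg⟩ := exists_surjective_nat G
  obtain ⟨φ', hφ', hφφ'⟩ := (MeasurableEmbedding.subtype_coe hY).exists_measurable_extend hφ
    fun _ => inferInstance
  obtain ⟨F, hF⟩ := hYc
  obtain ⟨c, R, hc, hcφ, hcont, hRc, hRd, hRg, hcR⟩ := exists_coloring_family hfree hY.compl
    ⟨F.image (·⁻¹), fun x => by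
      obtain ⟨f, hf, hfx⟩ := hF x
      exact ⟨f⁻¹, Finset.mem_image_of_mem _ hf, hfx⟩⟩ hφ' g
  have hclosure : ∀ w n, ∀ ω ∈ closure (range fun x (h : G) => c w (h⁻¹ • x)),
      (fun h => ω h⁻¹) ∈ R n (w n) := by
    intro w n
    refine closure_minimal (t := {ω : G → Bool | (fun h => ω h⁻¹) ∈ R n (w n)}) ?_
      ((hRc n (w n)).preimage (continuous_pi fun h => continuous_apply h⁻¹))
    rintro _ ⟨x, rfl⟩
    simpa only [mem_ofPred_eq, inv_inv] using hcR w n x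
  have hmeas : ∀ w, Measurable fun x (h : G) => c w (h⁻¹ • x) := fun w =>
    measurable_pi_iff.2 fun h => (hc w).comp (measurable_const_smul h⁻¹)
  have hcontinuous : ∀ x, Continuous fun w (h : G) => c w (h⁻¹ • x) := fun x =>
    continuous_pi fun h => hcont (h⁻¹ • x)
  refine ⟨fun w x h => c w (h⁻¹ • x), hmeas, fun w k x => ?_, fun w ω hω k hk hfix => ?_,
    fun w y => ?_, fun w z hwz => ?_,
    measurable_uncurry_of_continuous_of_measurable hcontinuous hmeas, hcontinuous⟩
  · funext h
    simp only [shift, mul_inv_rev, inv_inv, mul_smul]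
  · obtain ⟨n, rfl⟩ := hg k
    obtain ⟨t, ht⟩ := hRg n hk (w n) _ (hclosure w n ω hω)
    refine ht ?_
    simpa only [shift, mul_inv_rev] using congrFun hfix t⁻¹
  · simp only [inv_one, one_smul]
    rw [hcφ w y (not_not.2 y.2)]
    exact congrFun hφφ' y
  · obtain ⟨n, hn⟩ := Function.ne_iff.1 hwz
    refine eq_empty_of_forall_notMem fun ω ⟨hω, hω'⟩ => ?_
    have h1 := hclosure w n ω hω
    have h2 := hclosure z n ω hω'
    cases hw : w n <;> cases hz : z n <;> rw [hw] at h1 hn <;> rw [hz] at h2 hn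
    · exact hn rfl
    · exact disjoint_left.1 (hRd n) h2 h1
    · exact disjoint_left.1 (hRd n) h1 h2
    · exact hn rfl
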